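/- Let (u_p)_{p>1} be a family of low energy nodal solutions of (P_p) with concentration points x₁ = x⁺ and x₂ = x⁻, and fix r₀ > 0 such that B_{2r₀}(x₁) ∩ B_{2r₀}(x₂) = ∅. Then there exist p₀ > 1 and ϱ₀ ∈ (0, r₀/2) such that for any p > p₀, up to a subsequence, u_p(x) ≥ 1/p for all x ∈ B_{2ϱ₀}(x₁) and u_p(x) ≤ −1/p for all x ∈ B_{2ϱ₀}(x₂). -/

import Mathlib

open Real MeasureTheory Metric Filter Topology Bornology

noncomputable section

abbrev E2 : Type := EuclideanSpace ℝ (Fin 2)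

/-- Laplacian of `u : ℝ² → ℝ` via coordinate second derivatives. -/
def lap (u : E2 → ℝ) (x : E2) : ℝ :=
  ∑ i : Fin 2,
    fderiv ℝ (fun y => fderiv ℝ u y (EuclideanSpace.single i 1)) x (EuclideanSpace.single i 1)

/-- `u` is a (classical) solution of the Lane–Emden problem `(P_p)` on `Ω`. -/
def IsSolution (Ω : Set E2) (p : ℝ) (u : E2 → ℝ) : Prop :=
  ContDiffOn ℝ 2 u Ω ∧ ContinuousOn u (closure Ω) ∧
    (∀ x ∈ Ω, -lap u x = |u x| ^ (p - 1) * u x) ∧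
    (∀ x ∈ frontier Ω, u x = 0)

/-- `u` is a nodal (sign-changing) function on `Ω`. -/
def IsNodal (Ω : Set E2) (u : E2 → ℝ) : Prop :=
  (∃ x ∈ Ω, 0 < u x) ∧ (∃ x ∈ Ω, u x < 0)

/-- The Green function of `-Δ` on `Ω` with Dirichlet boundary conditions, together with
its regular part `H`, so that `G(x,y) = -(1/2π) log|x-y| + H(x,y)`. -/
structure GreenData (Ω : Set E2) where
  G : E2 → E2 → ℝ
  H : E2 → E2 → ℝ
  decomp : ∀ x y, G x y = -(1 / (2 * π)) * Real.log ‖x - y‖ + H x y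
  bdry : ∀ x ∈ Ω, ∀ y ∈ frontier Ω, G x y = 0
  symm : ∀ x y, G x y = G y x
  smoothH : ContDiffOn ℝ (⊤ : ℕ∞) (fun q : E2 × E2 => H q.1 q.2) (Ω ×ˢ Ω)
  contH : ∀ x ∈ Ω, ContinuousOn (H x) (closure Ω)
  harmH : ∀ x ∈ Ω, ∀ y ∈ Ω, lap (H x) y = 0

/-- The Kirchhoff–Routh type function `Ψ(a₁,a₂) = 2G(a₁,a₂) − R(a₁) − R(a₂)`. -/
def KR {Ω : Set E2} (gd : GreenData Ω) (q : E2 × E2) : ℝ :=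
  2 * gd.G q.1 q.2 - gd.H q.1 q.1 - gd.H q.2 q.2

/-- `q` is a non-degenerate critical point of `F`. -/
def NondegCrit (F : E2 × E2 → ℝ) (q : E2 × E2) : Prop :=
  fderiv ℝ F q = 0 ∧
    ∀ v : E2 × E2, (∀ w : E2 × E2, fderiv ℝ (fun r => fderiv ℝ F r) q v w = 0) → v = 0

/-- Convergence in `C²_loc(S)`: uniform convergence of all derivatives of order `≤ 2`
on compact subsets of `S`. -/
def TendstoC2LocOn (S : Set E2) (F : ℕ → E2 → ℝ) (g : E2 → ℝ) : Prop :=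
  ∀ K : Set E2, K ⊆ S → IsCompact K → ∀ k : ℕ, k ≤ 2 →
    TendstoUniformlyOn (fun n x => iteratedFDeriv ℝ k (F n) x)
      (fun x => iteratedFDeriv ℝ k g x) atTop K

/-- `‖u⁺‖_∞` on `closure Ω`. -/
def supPos (Ω : Set E2) (u : E2 → ℝ) : ℝ := sSup ((fun x => max (u x) 0) '' closure Ω)

/-- `‖u⁻‖_∞` on `closure Ω`. -/
def supNeg (Ω : Set E2) (u : E2 → ℝ) : ℝ := sSup ((fun x => max (-u x) 0) '' closure Ω)

/-- The energy functional `J_p`. -/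
def energy (Ω : Set E2) (p : ℝ) (u : E2 → ℝ) : ℝ :=
  (1 / 2) * (∫ x in Ω, ‖fderiv ℝ u x‖ ^ 2) - (1 / (p + 1)) * ∫ x in Ω, |u x| ^ (p + 1)

/-- The standard bubble `U(z) = −2 log(1 + |z|²/8)`. -/
def Ustd (z : E2) : ℝ := -2 * Real.log (1 + ‖z‖ ^ 2 / 8)

/-- Unit vector at angle `θ`. -/
def circDir (θ : ℝ) : E2 :=
  EuclideanSpace.single 0 (Real.cos θ) + EuclideanSpace.single 1 (Real.sin θ)

/-- Surface integral over the circle `∂B_r(c)`; the integrand may depend on the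
outer unit normal (first argument) and on the point (second argument). -/
def surfInt (c : E2) (r : ℝ) (F : E2 → E2 → ℝ) : ℝ :=
  ∫ θ in (0:ℝ)..(2 * π), r * F (circDir θ) (c + r • circDir θ)

/-- Inner product of gradients `⟨∇f, ∇g⟩`. -/
def gradInner (f g : E2 → ℝ) (x : E2) : ℝ :=
  ∑ j : Fin 2, fderiv ℝ f x (EuclideanSpace.single j 1) *
    fderiv ℝ g x (EuclideanSpace.single j 1)

/-- The quadratic form `P_i` (centred at `c`, radius `r`). -/
def Pform (c : E2) (r : ℝ) (f g : E2 → ℝ) : ℝ :=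
  -2 * r * surfInt c r (fun ν x => fderiv ℝ f x ν * fderiv ℝ g x ν) +
    r * surfInt c r (fun _ x => gradInner f g x)

/-- The quadratic form `Q_{ij}` (centred at `c`, radius `r`). -/
def Qform (c : E2) (r : ℝ) (j : Fin 2) (f g : E2 → ℝ) : ℝ :=
  surfInt c r (fun ν x =>
    -(fderiv ℝ f x (EuclideanSpace.single j 1)) * fderiv ℝ g x ν -
      fderiv ℝ f x ν * fderiv ℝ g x (EuclideanSpace.single j 1) +
      gradInner f g x * ν j)



/-- Circle integral (unnormalised). -/
def circI (f : E2 → ℝ) (c : E2) (s : ℝ) : ℝ := ∫ θ in (-π)..π, f (c + s • circDir θ)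

def circDir' (θ : ℝ) : E2 :=
  EuclideanSpace.single 0 (-Real.sin θ) + EuclideanSpace.single 1 (Real.cos θ)

lemma circDir_eq (θ : ℝ) : circDir θ = Real.cos θ • EuclideanSpace.single 0 (1:ℝ) +
    Real.sin θ • EuclideanSpace.single 1 (1:ℝ) := by
  ext j; fin_cases j <;> simp [circDir]

lemma circDir'_eq (θ : ℝ) : circDir' θ = (-Real.sin θ) • EuclideanSpace.single 0 (1:ℝ) +
    Real.cos θ • EuclideanSpace.single 1 (1:ℝ) := by
  ext j; fin_cases j <;> simp [circDir']

lemma continuous_circDir : Continuous circDir := by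
  have : circDir = fun θ => _ := funext circDir_eq
  rw [this]; fun_prop

lemma continuous_circDir' : Continuous circDir' := by
  have : circDir' = fun θ => _ := funext circDir'_eq
  rw [this]; fun_prop

lemma hasDerivAt_circDir (θ : ℝ) : HasDerivAt circDir (circDir' θ) θ := by
  have : circDir = fun θ => _ := funext circDir_eq
  rw [this, circDir'_eq]
  exact ((Real.hasDerivAt_cos θ).smul_const _).add ((Real.hasDerivAt_sin θ).smul_const _)

lemma hasDerivAt_circDir' (θ : ℝ) : HasDerivAt circDir' (-circDir θ) θ := by
  have : circDir' = fun θ => _ := funext circDir'_eq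
  rw [this, circDir_eq, neg_add, ← neg_smul, ← neg_smul]
  exact ((Real.hasDerivAt_sin θ).neg.smul_const _).add ((Real.hasDerivAt_cos θ).smul_const _)

lemma norm_circDir (θ : ℝ) : ‖circDir θ‖ = 1 := by
  rw [EuclideanSpace.norm_eq]; simp [circDir]

lemma mem_cb (c : E2) {s R : ℝ} (h : |s| ≤ R) (θ : ℝ) : c + s • circDir θ ∈ closedBall c R := by
  simp [mem_closedBall, dist_eq_norm, norm_smul, norm_circDir, h]

lemma polar_ball (F : E2 → ℝ) (c : E2) (s : ℝ) (hs : 0 ≤ s)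
    (hF : ContinuousOn F (closedBall c s)) :
    ∫ y in ball c s, F y = ∫ t in (0:ℝ)..s, t * circI F c t := by
  have h1 : ∫ y in ball c s, F y = ∫ z, (ball (0:E2) s).indicator (fun z => F (c + z)) z := by
    rw [← integral_indicator measurableSet_ball, ← integral_add_left_eq_self _ c]
    congr 1; ext z
    simp only [Set.indicator, mem_ball, dist_eq_norm]
    simp
  have h2 := (Complex.orthonormalBasisOneI.measurePreserving_measurableEquiv).integral_comp
    (Complex.orthonormalBasisOneI.measurableEquiv.measurableEmbedding)
    ((ball (0:E2) s).indicator (fun z => F (c + z)))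
  have h3 : ∀ q : ℝ × ℝ, Complex.orthonormalBasisOneI.measurableEquiv (Complex.polarCoord.symm q) =
      q.1 • circDir q.2 := by
    intro q
    change Complex.orthonormalBasisOneI.repr _ = _
    ext j
    fin_cases j
    · simp [circDir, Complex.orthonormalBasisOneI]
      exact Or.inl (Complex.cos_ofReal_re _)
    · simp [circDir, Complex.orthonormalBasisOneI]
      exact Or.inl (Complex.sin_ofReal_re _)
  rw [h1, ← h2, ← Complex.integral_comp_polarCoord_symm]
  simp only [h3]
  have h4 : ∫ q in polarCoord.target, q.1 • (ball (0:E2) s).indicator (fun z => F (c + z)) (q.1 • circDir q.2)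
      = ∫ q in Set.Ioc (0:ℝ) s ×ˢ Set.Ioc (-π) π, q.1 * F (c + q.1 • circDir q.2) := by
    have : ∫ q in polarCoord.target, q.1 • (ball (0:E2) s).indicator (fun z => F (c + z)) (q.1 • circDir q.2)
      = ∫ q in Set.Ioo (0:ℝ) s ×ˢ Set.Ioo (-π) π, q.1 * F (c + q.1 • circDir q.2) := by
      rw [← integral_indicator polarCoord.open_target.measurableSet,
        ← integral_indicator (measurableSet_Ioo.prod measurableSet_Ioo)]
      congr 1; ext ⟨a, b⟩
      simp only [Set.indicator, polarCoord_target, Set.mem_prod, Set.mem_Ioi, Set.mem_Ioo, mem_ball,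
        dist_zero_right, norm_smul, norm_circDir, mul_one, Real.norm_eq_abs, smul_eq_mul]
      by_cases ha : 0 < a <;> by_cases hb : -π < b ∧ b < π <;> simp [ha, hb, abs_of_pos]
    rw [this]
    apply setIntegral_congr_set
    exact Measure.set_prod_ae_eq Ioo_ae_eq_Ioc Ioo_ae_eq_Ioc
  rw [h4, Measure.volume_eq_prod, setIntegral_prod]
  · rw [intervalIntegral.integral_of_le hs]
    congr 1; ext t
    rw [circI, intervalIntegral.integral_of_le (by linarith [Real.pi_pos]), integral_const_mul]
  · rw [← Measure.volume_eq_prod]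
    apply IntegrableOn.mono_set (t := Set.Icc (0:ℝ) s ×ˢ Set.Icc (-π) π)
    · apply ContinuousOn.integrableOn_compact (isCompact_Icc.prod isCompact_Icc)
      refine continuousOn_fst.mul (hF.comp ?_ ?_)
      · exact (continuous_const.add (continuous_fst.smul (continuous_circDir.comp continuous_snd))).continuousOn
      · rintro ⟨a, b⟩ ⟨ha, hb⟩
        exact mem_cb c (by rw [abs_of_nonneg ha.1]; exact ha.2) _
    · exact Set.prod_mono Set.Ioc_subset_Icc_self Set.Ioc_subset_Icc_self

lemma hasDerivAt_param (F F' : ℝ → ℝ → ℝ) (I : Set ℝ) (hI : IsOpen I) (s : ℝ) (hs : s ∈ I)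
    (hF : ∀ t ∈ I, Continuous (F t))
    (hF' : ContinuousOn (fun q : ℝ × ℝ => F' q.1 q.2) (I ×ˢ Set.univ))
    (hd : ∀ t ∈ I, ∀ θ, HasDerivAt (fun t => F t θ) (F' t θ) t) :
    HasDerivAt (fun t => ∫ θ in (-π)..π, F t θ) (∫ θ in (-π)..π, F' s θ) s := by
  obtain ⟨ε, hε, hball⟩ := Metric.nhds_basis_closedBall.mem_iff.1 (hI.mem_nhds hs)
  have hc : IsCompact (closedBall s ε ×ˢ Set.Icc (-π) π) := (isCompact_closedBall s ε).prod isCompact_Icc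
  obtain ⟨C, hC⟩ := hc.exists_bound_of_continuousOn (hF'.mono (Set.prod_mono hball (Set.subset_univ _)))
  have hle : -π ≤ π := by linarith [Real.pi_pos]
  refine (intervalIntegral.hasDerivAt_integral_of_dominated_loc_of_deriv_le
    (s := closedBall s ε) (bound := fun _ => C) (closedBall_mem_nhds s hε) ?_ ?_ ?_ ?_ ?_ ?_).2
  · filter_upwards [hI.mem_nhds hs] with t ht
    exact (hF t ht).aestronglyMeasurable
  · exact (hF s hs).intervalIntegrable _ _
  · have : Continuous (F' s) := by
      rw [← continuousOn_univ]
      exact hF'.comp (f := fun θ => (s, θ)) (by fun_prop) (fun θ _ => ⟨hs, trivial⟩)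
    exact this.aestronglyMeasurable
  · refine Eventually.of_forall fun θ hθ t ht => ?_
    rw [Set.uIoc_of_le hle] at hθ
    exact hC (t, θ) ⟨ht, Set.Ioc_subset_Icc_self hθ⟩
  · exact intervalIntegrable_const
  · exact Eventually.of_forall fun θ _ t ht => hd t (hball ht) θ


lemma lap_eq {f : E2 → ℝ} {y : E2} (h : DifferentiableAt ℝ (fderiv ℝ f) y) (θ : ℝ) :
    lap f y = fderiv ℝ (fderiv ℝ f) y (circDir θ) (circDir θ) +
      fderiv ℝ (fderiv ℝ f) y (circDir' θ) (circDir' θ) := by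
  have h1 : ∀ v : E2, fderiv ℝ (fun y => fderiv ℝ f y v) y v = fderiv ℝ (fderiv ℝ f) y v v := by
    intro v
    have := (h.hasFDerivAt.clm_apply (hasFDerivAt_const v y)).fderiv
    rw [this]; simp
  simp only [lap, h1, Fin.sum_univ_two, circDir_eq, circDir'_eq, map_add, map_smul,
    _root_.add_apply, _root_.smul_apply, smul_eq_mul]
  have := Real.sin_sq_add_cos_sq θ
  linear_combination (-(fderiv ℝ (fderiv ℝ f) y (EuclideanSpace.single 0 1) (EuclideanSpace.single 0 1))
    - (fderiv ℝ (fderiv ℝ f) y (EuclideanSpace.single 1 1) (EuclideanSpace.single 1 1))) * this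

lemma mem_b (c : E2) {s R : ℝ} (h : s ∈ Set.Ioo (-R) R) (θ : ℝ) : c + s • circDir θ ∈ ball c R := by
  simp [mem_ball, dist_eq_norm, norm_smul, norm_circDir, abs_lt, h.1, h.2]

lemma circI_main (f : E2 → ℝ) (c : E2) (R : ℝ) (hR : 0 < R) (hf : ContDiffOn ℝ 2 f (ball c R)) :
    ContinuousOn (lap f) (ball c R) ∧ ContinuousOn (circI f c) (Set.Ioo (-R) R) ∧
    ∀ s ∈ Set.Ioo 0 R, HasDerivAt (circI f c) (s⁻¹ * ∫ y in ball c s, lap f y) s := by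
  have ho : IsOpen (ball c R) := isOpen_ball
  set f1 := fderiv ℝ f with hf1
  set f2 := fderiv ℝ f1 with hf2
  have c1 : ContDiffOn ℝ 1 f1 (ball c R) := hf.fderiv_of_isOpen ho (by norm_num)
  have c2 : ContinuousOn f2 (ball c R) := (c1.fderiv_of_isOpen (m := 0) ho (by norm_num)).continuousOn
  have d0 : ∀ y ∈ ball c R, HasFDerivAt f (f1 y) y := fun y hy =>
    ((hf.differentiableOn (by norm_num)).differentiableAt (ho.mem_nhds hy)).hasFDerivAt
  have d1 : ∀ y ∈ ball c R, HasFDerivAt f1 (f2 y) y := fun y hy =>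
    ((c1.differentiableOn (by norm_num)).differentiableAt (ho.mem_nhds hy)).hasFDerivAt
  have c0 := hf.continuousOn
  have c1' := c1.continuousOn
  have hpt : Continuous (fun q : ℝ × ℝ => c + q.1 • circDir q.2) :=
    continuous_const.add (continuous_fst.smul (continuous_circDir.comp continuous_snd))
  have hmaps : Set.MapsTo (fun q : ℝ × ℝ => c + q.1 • circDir q.2) (Set.Ioo (-R) R ×ˢ Set.univ) (ball c R) :=
    fun q hq => mem_b c hq.1 q.2
  have hsd : ∀ t : ℝ, Continuous (fun θ : ℝ => t • circDir θ) := fun t => by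
    have := continuous_circDir
    fun_prop
  have hsd' : ∀ t : ℝ, Continuous (fun θ : ℝ => t • circDir' θ) := fun t => by
    have := continuous_circDir'
    fun_prop
  have hptθ : ∀ t, Continuous (fun θ : ℝ => c + t • circDir θ) := fun t =>
    continuous_const.add (hsd t)
  have hcd : Continuous (fun q : ℝ × ℝ => circDir q.2) := continuous_circDir.comp continuous_snd
  have hcd' := continuous_circDir'
  have hcdd := continuous_circDir
  have hdt : ∀ t θ, HasDerivAt (fun t : ℝ => c + t • circDir θ) (circDir θ) t := by
    intro t θ
    simpa using ((hasDerivAt_id t).smul_const (circDir θ)).const_add c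
  have hlap : ContinuousOn (lap f) (ball c R) := by
    have : ContinuousOn (fun y => f2 y (circDir 0) (circDir 0) + f2 y (circDir' 0) (circDir' 0)) (ball c R) :=
      ((c2.clm_apply continuousOn_const).clm_apply continuousOn_const).add
        ((c2.clm_apply continuousOn_const).clm_apply continuousOn_const)
    exact this.congr fun y hy => lap_eq (d1 y hy).differentiableAt 0
  -- first derivative
  have hm1 : ∀ s ∈ Set.Ioo (-R) R, HasDerivAt (circI f c)
      (∫ θ in (-π)..π, f1 (c + s • circDir θ) (circDir θ)) s := by
    intro s hs
    refine hasDerivAt_param (fun t θ => f (c + t • circDir θ))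
      (fun t θ => f1 (c + t • circDir θ) (circDir θ)) (Set.Ioo (-R) R) isOpen_Ioo s hs ?_ ?_ ?_
    · intro t ht
      rw [← continuousOn_univ]
      exact c0.comp (hptθ t).continuousOn (fun θ _ => mem_b c ht θ)
    · exact (c1'.comp hpt.continuousOn hmaps).clm_apply hcd.continuousOn
    · intro t ht θ
      exact (d0 _ (mem_b c ht θ)).comp_hasDerivAt t (hdt t θ)
  -- second derivative
  have hq : ∀ s ∈ Set.Ioo (-R) R, HasDerivAt
      (fun t => ∫ θ in (-π)..π, f1 (c + t • circDir θ) (t • circDir θ))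
      (s * circI (lap f) c s) s := by
    intro s hs
    have key := hasDerivAt_param (fun t θ => f1 (c + t • circDir θ) (t • circDir θ))
      (fun t θ => f2 (c + t • circDir θ) (circDir θ) (t • circDir θ) + f1 (c + t • circDir θ) (circDir θ))
      (Set.Ioo (-R) R) isOpen_Ioo s hs ?_ ?_ ?_
    · convert key using 1
      have hc1 : Continuous (fun θ => f1 (c + s • circDir θ)) := by
        rw [← continuousOn_univ]
        exact c1'.comp (hptθ s).continuousOn (fun θ _ => mem_b c hs θ)
      have hc2 : Continuous (fun θ => f2 (c + s • circDir θ)) := by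
        rw [← continuousOn_univ]
        exact c2.comp (hptθ s).continuousOn (fun θ _ => mem_b c hs θ)
      have hK : ∫ θ in (-π)..π, (f2 (c + s • circDir θ) (s • circDir' θ) (circDir' θ) +
          f1 (c + s • circDir θ) (-circDir θ)) = 0 := by
        rw [intervalIntegral.integral_eq_sub_of_hasDerivAt
          (f := fun θ => f1 (c + s • circDir θ) (circDir' θ))]
        · simp [circDir_eq, circDir'_eq]
        · intro θ _
          have e1 : HasDerivAt (fun θ => c + s • circDir θ) (s • circDir' θ) θ :=
            ((hasDerivAt_circDir θ).const_smul s).const_add c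
          have e2 := (d1 _ (mem_b c hs θ)).comp_hasDerivAt θ e1
          exact e2.clm_apply (hasDerivAt_circDir' θ)
        · apply Continuous.intervalIntegrable
          exact ((hc2.clm_apply (hsd' s)).clm_apply hcd').add (hc1.clm_apply hcdd.neg)
      have hsum : ∫ θ in (-π)..π, (f2 (c + s • circDir θ) (circDir θ) (s • circDir θ) +
          f1 (c + s • circDir θ) (circDir θ)) = ∫ θ in (-π)..π,
          ((f2 (c + s • circDir θ) (circDir θ) (s • circDir θ) +
          f1 (c + s • circDir θ) (circDir θ)) + (f2 (c + s • circDir θ) (s • circDir' θ) (circDir' θ) +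
          f1 (c + s • circDir θ) (-circDir θ))) := by
        rw [intervalIntegral.integral_add (μ := volume) (f := fun θ => f2 (c + s • circDir θ) (circDir θ) (s • circDir θ) +
          f1 (c + s • circDir θ) (circDir θ)), hK, add_zero]
        · apply Continuous.intervalIntegrable
          exact ((hc2.clm_apply hcdd).clm_apply (hsd s)).add (hc1.clm_apply hcdd)
        · apply Continuous.intervalIntegrable
          exact ((hc2.clm_apply (hsd' s)).clm_apply hcd').add (hc1.clm_apply hcdd.neg)
      rw [hsum, circI, ← intervalIntegral.integral_const_mul]
      congr 1; ext θ
      rw [lap_eq (d1 _ (mem_b c hs θ)).differentiableAt θ]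
      simp only [map_smul, map_neg, _root_.smul_apply, smul_eq_mul, ← hf1, ← hf2]
      ring
    · intro t ht
      rw [← continuousOn_univ]
      exact (c1'.comp (hptθ t).continuousOn (fun θ _ => mem_b c ht θ)).clm_apply
        (hsd t).continuousOn
    · exact (((c2.comp hpt.continuousOn hmaps).clm_apply hcd.continuousOn).clm_apply
        (continuous_fst.smul hcd).continuousOn).add
        ((c1'.comp hpt.continuousOn hmaps).clm_apply hcd.continuousOn)
    · intro t ht θ
      have e2 := (d1 _ (mem_b c ht θ)).comp_hasDerivAt t (hdt t θ)
      have e3 : HasDerivAt (fun t : ℝ => t • circDir θ) (circDir θ) t := by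
        simpa using (hasDerivAt_id t).smul_const (circDir θ)
      exact e2.clm_apply e3
  refine ⟨hlap, fun s hs => (hm1 s hs).continuousAt.continuousWithinAt, fun s hs => ?_⟩
  have hs' : s ∈ Set.Ioo (-R) R := ⟨by linarith [hs.1], hs.2⟩
  have hcI : ContinuousOn (circI (lap f) c) (Set.Icc 0 s) := by
    have hg : Continuous (fun t => ∫ θ in (-π)..π,
        lap f (c + ((Set.projIcc 0 s hs.1.le t : Set.Icc 0 s) : ℝ) • circDir θ)) := by
      apply intervalIntegral.continuous_parametric_intervalIntegral_of_continuous'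
      rw [← continuousOn_univ]
      refine hlap.comp (f := fun q : ℝ × ℝ => c + ((Set.projIcc 0 s hs.1.le q.1 : Set.Icc 0 s) : ℝ) • circDir q.2)
        ?_ ?_
      · exact (continuous_const.add ((continuous_subtype_val.comp
          (continuous_projIcc.comp continuous_fst)).smul hcd)).continuousOn
      · intro q _
        have := (Set.projIcc 0 s hs.1.le q.1).2
        exact mem_b c ⟨by linarith [this.1, hs.1, hs.2], by linarith [this.2, hs.2]⟩ _
    refine hg.continuousOn.congr fun t ht => ?_
    simp only [circI, Set.projIcc_of_mem hs.1.le ht]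
  convert hm1 s hs' using 1
  rw [polar_ball _ _ _ hs.1.le (hlap.mono (closedBall_subset_ball hs.2)),
    intervalIntegral.integral_eq_sub_of_hasDerivAt
      (f := fun t => ∫ θ in (-π)..π, f1 (c + t • circDir θ) (t • circDir θ))]
  · simp only [map_smul, smul_eq_mul, intervalIntegral.integral_const_mul]
    have := hs.1.ne'
    field_simp
    simp
  · intro t ht
    rw [Set.uIcc_of_le hs.1.le] at ht
    exact hq t ⟨by linarith [ht.1, hs.1, hs.2], by linarith [ht.2, hs.2]⟩
  · apply ContinuousOn.intervalIntegrable
    rw [Set.uIcc_of_le hs.1.le]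
    exact continuousOn_id.mul hcI

lemma circI_zero (f : E2 → ℝ) (c : E2) : circI f c 0 = 2 * π * f c := by
  have : circI f c 0 = ∫ θ in (-π)..π, f c := by simp [circI]
  rw [this, intervalIntegral.integral_const, smul_eq_mul]; ring

lemma circI_ge (f : E2 → ℝ) (c : E2) (s α : ℝ) (hf : ContinuousOn f (closedBall c |s|))
    (h : ∀ θ, α ≤ f (c + s • circDir θ)) : 2 * π * α ≤ circI f c s := by
  have : ∫ θ in (-π)..π, α ≤ circI f c s := by
    apply intervalIntegral.integral_mono_on (by linarith [Real.pi_pos]) intervalIntegrable_const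
    · apply Continuous.intervalIntegrable
      rw [← continuousOn_univ]
      refine hf.comp ?_ (fun θ _ => mem_cb c le_rfl θ)
      have := continuous_circDir
      fun_prop
    · intro θ _; exact h θ
  simp at this
  linarith

lemma circI_neg (f : E2 → ℝ) (c : E2) (s : ℝ) : circI (fun x => - f x) c s = - circI f c s := by
  simp [circI]

lemma circI_le (f : E2 → ℝ) (c : E2) (s α : ℝ) (hf : ContinuousOn f (closedBall c |s|))
    (h : ∀ θ, f (c + s • circDir θ) ≤ α) : circI f c s ≤ 2 * π * α := by
  have := circI_ge (fun x => - f x) c s (-α) hf.neg (fun θ => neg_le_neg (h θ))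
  rw [circI_neg] at this
  linarith

/-- Basic monotonicity tool. -/
lemma circI_mono {f : E2 → ℝ} {c : E2} {R : ℝ} (hR : 0 < R) (hf : ContDiffOn ℝ 2 f (ball c R))
    (ψ ψ' : ℝ → ℝ) {a b : ℝ} (ha : 0 ≤ a) (hab : a ≤ b) (hb : b < R)
    (hψc : ContinuousOn ψ (Set.Icc a b))
    (hψ : ∀ s ∈ Set.Ioo a b, HasDerivAt ψ (ψ' s) s)
    (h : ∀ s ∈ Set.Ioo a b, - ∫ y in ball c s, lap f y ≤ s * ψ' s) :
    circI f c a + ψ a ≤ circI f c b + ψ b := by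
  obtain ⟨_, hc, hd⟩ := circI_main f c R hR hf
  have hsub : Set.Icc a b ⊆ Set.Ioo (-R) R := fun s hs => ⟨by linarith [hs.1], by linarith [hs.2]⟩
  have hD : ∀ s ∈ Set.Ioo a b, HasDerivAt (fun s => circI f c s + ψ s)
      (s⁻¹ * (∫ y in ball c s, lap f y) + ψ' s) s := fun s hs =>
    (hd s ⟨by linarith [hs.1], by linarith [hs.2]⟩).add (hψ s hs)
  have hm : MonotoneOn (fun s => circI f c s + ψ s) (Set.Icc a b) := by
    apply monotoneOn_of_deriv_nonneg (convex_Icc a b) ((hc.mono hsub).add hψc)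
    · rw [interior_Icc]
      exact fun s hs => (hD s hs).differentiableAt.differentiableWithinAt
    · rw [interior_Icc]
      intro s hs
      change 0 ≤ deriv (fun s => circI f c s + ψ s) s
      rw [(hD s hs).deriv]
      have h0 : 0 < s := by linarith [hs.1]
      have h1 := h s hs
      have : s⁻¹ * (∫ y in ball c s, lap f y) + ψ' s = s⁻¹ * ((∫ y in ball c s, lap f y) + s * ψ' s) := by
        field_simp
      rw [this]
      exact mul_nonneg (inv_nonneg.2 h0.le) (by linarith)
  exact hm ⟨le_rfl, hab⟩ ⟨hab, le_rfl⟩ hab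

lemma circI_log {f : E2 → ℝ} {c : E2} {R : ℝ} (hR : 0 < R) (hf : ContDiffOn ℝ 2 f (ball c R))
    {a b K : ℝ} (ha : 0 < a) (hab : a ≤ b) (hb : b < R)
    (h : ∀ s ∈ Set.Ioo a b, - ∫ y in ball c s, lap f y ≤ K) :
    circI f c a - circI f c b ≤ K * Real.log (b / a) := by
  have := circI_mono hR hf (fun s => K * Real.log s) (fun s => K * s⁻¹) ha.le hab hb
    (fun s hs => ((Real.continuousAt_log (by linarith [hs.1])).const_mul K).continuousWithinAt)
    (fun s hs => (Real.hasDerivAt_log (by linarith [hs.1])).const_mul K)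
    (fun s hs => by
      have : s ≠ 0 := by linarith [hs.1]
      have e : s * (K * s⁻¹) = K := by field_simp
      rw [e]; exact h s hs)
  rw [Real.log_div (by linarith) (by linarith)]
  linarith

lemma vol_ball (c : E2) {s : ℝ} (hs : 0 ≤ s) : volume.real (ball c s) = π * s ^ 2 := by
  rw [Measure.real, EuclideanSpace.volume_ball_fin_two]
  simp [ENNReal.toReal_mul, hs, Real.pi_pos.le]
  ring

lemma circI_quad {f : E2 → ℝ} {c : E2} {R : ℝ} (hR : 0 < R) (hf : ContDiffOn ℝ 2 f (ball c R))
    {a K : ℝ} (ha : 0 ≤ a) (hb : a < R)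
    (h : ∀ y ∈ ball c a, - lap f y ≤ K) :
    2 * π * f c - circI f c a ≤ π * K * a ^ 2 / 2 := by
  obtain ⟨hl, _, _⟩ := circI_main f c R hR hf
  have := circI_mono hR hf (fun s => π * K * s ^ 2 / 2) (fun s => π * K * s) le_rfl ha hb
    (by fun_prop)
    (fun s hs => by
      have := ((hasDerivAt_pow 2 s).const_mul (π * K)).div_const 2
      refine HasDerivAt.congr_deriv (f' := π * K * ((2:ℕ) * s ^ (2 - 1)) / 2) this ?_
      norm_num; ring)
    (fun s hs => by
      rw [← integral_neg]
      have hi : IntegrableOn (fun y => - lap f y) (ball c s) := by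
        apply IntegrableOn.mono_set _ ball_subset_closedBall
        exact ((hl.mono (closedBall_subset_ball (by linarith [hs.2]))).neg).integrableOn_compact
          (isCompact_closedBall c s)
      calc ∫ y in ball c s, -lap f y ≤ ∫ y in ball c s, K := by
            apply setIntegral_mono_on hi _ measurableSet_ball
            · exact fun y hy => h y (ball_subset_ball hs.2.le hy)
            · exact integrableOn_const measure_ball_lt_top.ne
        _ = s * (π * K * s) := by
            rw [setIntegral_const, vol_ball c hs.1.le, smul_eq_mul]; ring)
  rw [circI_zero] at this
  linarith [this]

lemma cont_nl {p : ℝ} (hp : 1 < p) : Continuous (fun t : ℝ => |t| ^ (p - 1) * t) :=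
  (continuous_abs.rpow_const (fun _ => Or.inr (by linarith))).mul continuous_id

lemma cont_neg {p : ℝ} (hp : 1 < p) : Continuous (fun t : ℝ => (max t 0) ^ p) :=
  (continuous_id.max continuous_const).rpow_const (fun _ => Or.inr (by linarith))

lemma nl_of_nonneg {p t : ℝ} (hp : 1 < p) (ht : 0 ≤ t) : |t| ^ (p - 1) * t = t ^ p := by
  rw [abs_of_nonneg ht]
  rcases ht.eq_or_lt with rfl | h
  · rw [mul_zero, Real.zero_rpow (by linarith)]
  · rw [Real.rpow_sub_one h.ne']; field_simp

lemma nl_nonpos {p t : ℝ} (ht : t ≤ 0) : |t| ^ (p - 1) * t ≤ 0 :=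
  mul_nonpos_of_nonneg_of_nonpos (Real.rpow_nonneg (abs_nonneg _) _) ht

lemma nl_le_pos {p t : ℝ} (hp : 1 < p) : |t| ^ (p - 1) * t ≤ (max t 0) ^ p := by
  rcases le_total 0 t with h | h
  · rw [nl_of_nonneg hp h, max_eq_left h]
  · exact (nl_nonpos h).trans (Real.rpow_nonneg (le_max_right _ _) _)

lemma nl_split {p t : ℝ} (hp : 1 < p) : |t| ^ p = |t| ^ (p - 1) * t + 2 * (max (-t) 0) ^ p := by
  rcases le_total 0 t with h | h
  · rw [nl_of_nonneg hp h, max_eq_right (by linarith), abs_of_nonneg h, Real.zero_rpow (by linarith)]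
    ring
  · have := nl_of_nonneg hp (t := -t) (by linarith)
    rw [abs_neg] at this
    rw [max_eq_left (by linarith), abs_of_nonpos h]
    rw [abs_of_nonpos h] at this
    linarith

/-- lower bound on the mass of the positive part near an interior maximum -/
lemma mass_lower {v : E2 → ℝ} {p R R' : ℝ} {x0 : E2} (hp : 1 < p) (hR : 0 < R) (hRR : R < R')
    (hR1 : R ≤ 1) (hpR : 1 ≤ p * R ^ 2)
    (hv : ContDiffOn ℝ 2 v (ball x0 R'))
    (heq : ∀ x ∈ ball x0 R', - lap v x = |v x| ^ (p - 1) * v x)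
    (hpos : 0 < v x0) (hmax : ∀ x ∈ ball x0 R, v x ≤ v x0) (hcirc : circI v x0 R ≤ 0) :
    4 * π ≤ π / p + (∫ y in ball x0 R, (max (v y) 0) ^ p) * (Real.log p + p / Real.exp 1) := by
  have hR' : 0 < R' := by linarith
  have hpi := Real.pi_pos
  set M := v x0 with hM
  set N := ∫ y in ball x0 R, (max (v y) 0) ^ p with hN
  have hlapM : ∀ y ∈ ball x0 R, - lap v y ≤ M ^ p := by
    intro y hy
    rw [heq y (ball_subset_ball hRR.le hy)]
    refine (nl_le_pos hp).trans (Real.rpow_le_rpow (le_max_right _ _) ?_ (by linarith))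
    exact max_le (hmax y hy) hpos.le
  have h1 := circI_quad hR' hv hR.le hRR hlapM
  have hM1 : 1 ≤ M := by
    by_contra hlt
    push Not at hlt
    have h2 : M ^ p ≤ M := by
      have := Real.rpow_le_rpow_of_exponent_ge hpos hlt.le hp.le
      simpa using this
    have h3 : R ^ 2 ≤ 1 := by nlinarith
    have h4 : M ^ p * R ^ 2 ≤ M := by
      have : 0 ≤ M ^ p := Real.rpow_nonneg hpos.le _
      nlinarith
    have : 2 * π * M ≤ π * (M ^ p * R ^ 2) / 2 := by
      have e : π * M ^ p * R ^ 2 = π * (M ^ p * R ^ 2) := by ring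
      rw [e] at h1
      linarith
    have h5 : π * (M ^ p * R ^ 2) ≤ π * M := mul_le_mul_of_nonneg_left h4 hpi.le
    have h6 : 0 < π * M := by positivity
    linarith
  have hMp : 1 ≤ M ^ p := Real.one_le_rpow hM1 (by linarith)
  have hp0 : 0 < p := by linarith
  set T := p * M ^ p with hT
  have hTpos : 0 < T := by positivity
  set s0 := (Real.sqrt T)⁻¹ with hs0
  have hs0pos : 0 < s0 := by positivity
  have hs0sq : s0 ^ 2 = T⁻¹ := by rw [hs0, inv_pow, Real.sq_sqrt hTpos.le]
  have hs0R : s0 ≤ R := by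
    rw [← sq_le_sq₀ hs0pos.le hR.le]
    rw [hs0sq, inv_le_iff_one_le_mul₀ hTpos, hT]
    nlinarith [sq_nonneg R]
  have h2 := circI_quad hR' hv hs0pos.le (by linarith) (fun y hy => hlapM y (ball_subset_ball hs0R hy))
  have e2 : π * M ^ p * s0 ^ 2 / 2 = π / (2 * p) := by
    rw [hs0sq, hT]
    have : M ^ p ≠ 0 := by positivity
    field_simp
  rw [e2] at h2
  have hcv : ContinuousOn v (closedBall x0 R) := hv.continuousOn.mono (closedBall_subset_ball hRR)
  have hiN : IntegrableOn (fun y => (max (v y) 0) ^ p) (ball x0 R) :=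
    (((cont_neg hp).comp_continuousOn hcv).integrableOn_compact
      (isCompact_closedBall x0 R)).mono_set ball_subset_closedBall
  have hiL : IntegrableOn (fun y => |v y| ^ (p - 1) * v y) (ball x0 R) :=
    (((cont_nl hp).comp_continuousOn hcv).integrableOn_compact
      (isCompact_closedBall x0 R)).mono_set ball_subset_closedBall
  have hN0 : 0 ≤ N := setIntegral_nonneg measurableSet_ball
    (fun y _ => Real.rpow_nonneg (le_max_right _ _) _)
  have h3 := circI_log hR' hv hs0pos hs0R hRR (K := N) (fun s hs => by
    have hsR : ball x0 s ⊆ ball x0 R := ball_subset_ball hs.2.le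
    calc - ∫ y in ball x0 s, lap v y = ∫ y in ball x0 s, |v y| ^ (p - 1) * v y := by
          rw [← integral_neg]
          exact setIntegral_congr_fun measurableSet_ball
            (fun y hy => heq y (ball_subset_ball (by linarith [hs.2]) hy))
      _ ≤ ∫ y in ball x0 s, (max (v y) 0) ^ p :=
          setIntegral_mono_on (hiL.mono_set hsR) (hiN.mono_set hsR) measurableSet_ball
            (fun y _ => nl_le_pos hp)
      _ ≤ N := setIntegral_mono_set hiN
          (Eventually.of_forall fun y => Real.rpow_nonneg (le_max_right _ _) _) hsR.eventuallyLE)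
  have h4 : Real.log (R / s0) ≤ (Real.log p + p * Real.log M) / 2 := by
    rw [Real.log_div hR.ne' hs0pos.ne', hs0, Real.log_inv, Real.log_sqrt hTpos.le, hT,
      Real.log_mul hp0.ne' (by positivity), Real.log_rpow hpos]
    linarith [Real.log_nonpos hR.le hR1]
  have h5 : Real.log M ≤ M / Real.exp 1 := by
    have := Real.log_le_sub_one_of_pos (x := M / Real.exp 1) (by positivity)
    rw [Real.log_div hpos.ne' (Real.exp_pos 1).ne', Real.log_exp] at this
    linarith
  have h6 : N * Real.log (R / s0) ≤ N * ((Real.log p + p * (M / Real.exp 1)) / 2) := by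
    apply mul_le_mul_of_nonneg_left _ hN0
    have := mul_le_mul_of_nonneg_left h5 hp0.le
    linarith
  have hlp : 0 ≤ Real.log p := Real.log_nonneg hp.le
  have h7 : 2 * π * M ≤ π / (2 * p) + N * ((Real.log p + p * (M / Real.exp 1)) / 2) := by linarith
  have h8 : π / (2 * p) ≤ π / (2 * p) * M := le_mul_of_one_le_right (by positivity) hM1
  have h9 : N * Real.log p ≤ N * Real.log p * M := le_mul_of_one_le_right (by positivity) hM1
  have h10 : M * (4 * π) ≤ M * (π / p + N * (Real.log p + p / Real.exp 1)) := by
    have e1 : π / (2 * p) * M = M * (π / p) / 2 := by field_simp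
    have e3 : p * (M / Real.exp 1) = M * (p / Real.exp 1) := by ring
    rw [e3] at h7
    rw [e1] at h8
    nlinarith
  exact le_of_mul_le_mul_left h10 hpos


lemma lap_neg (u : E2 → ℝ) (x : E2) : lap (fun x => - u x) x = - lap u x := by
  simp only [lap]
  rw [← Finset.sum_neg_distrib]
  apply Finset.sum_congr rfl
  intro i _
  simp [fderiv_fun_neg]

lemma near_point {u : E2 → ℝ} {p r : ℝ} {c : E2} (hp : 1 < p) (hr : 0 < r) (hr1 : 2 * r ≤ 1)
    (hpr : 1 ≤ p * (2 * r) ^ 2)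
    (hu : ContDiffOn ℝ 2 u (ball c (4 * r)))
    (heq : ∀ x ∈ ball c (4 * r), - lap u x = |u x| ^ (p - 1) * u x)
    (hann : ∀ x, r ≤ dist x c → dist x c ≤ 3 * r → 1 / p ≤ u x) :
    (∀ y ∈ ball c r, 1 / p ≤ u y) ∨
    4 * π ≤ π / p + (∫ y in ball c (3 * r), (max (-u y) 0) ^ p) * (Real.log p + p / Real.exp 1) := by
  have hp0 : 0 < p := by linarith
  have hpi := Real.pi_pos
  have hcu : ContinuousOn u (closedBall c (3 * r)) :=
    hu.continuousOn.mono (closedBall_subset_ball (by linarith))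
  have hcirc : ∀ x ∈ ball c r, ∀ θ, 1 / p ≤ u (x + (2 * r) • circDir θ) := by
    intro x hx θ
    have e1 : dist (x + (2 * r) • circDir θ) x = 2 * r := by
      simp [dist_eq_norm, norm_smul, norm_circDir, abs_of_pos hr]
    have e2 := dist_triangle (x + (2 * r) • circDir θ) x c
    have e3 := dist_triangle_right (x + (2 * r) • circDir θ) x c
    rw [mem_ball] at hx
    exact hann _ (by linarith) (by linarith)
  have hb4 : ∀ x ∈ ball c r, ball x (3 * r) ⊆ ball c (4 * r) := fun x hx =>
    ball_subset_ball' (by rw [mem_ball] at hx; linarith)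
  have hb3 : ∀ x ∈ ball c r, ball x (2 * r) ⊆ ball c (3 * r) := fun x hx =>
    ball_subset_ball' (by rw [mem_ball] at hx; linarith)
  have hccirc : ∀ x ∈ ball c r, 2 * π * (1 / p) ≤ circI u x (2 * r) := by
    intro x hx
    apply circI_ge _ _ _ _ _ (hcirc x hx)
    rw [abs_of_pos (by linarith)]
    exact hu.continuousOn.mono ((closedBall_subset_ball (by linarith)).trans (hb4 x hx))
  obtain ⟨x0, hx0, hmin⟩ := (isCompact_closedBall c (3 * r)).exists_isMinOn
    ⟨c, mem_closedBall_self (by linarith)⟩ hcu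
  by_cases hneg : u x0 < 0
  · right
    have hx0r : x0 ∈ ball c r := by
      by_contra hcon
      rw [mem_ball, not_lt] at hcon
      have := hann x0 hcon hx0
      have : 0 < 1 / p := by positivity
      linarith
    have key := mass_lower (v := fun x => - u x) (R := 2 * r) (R' := 3 * r) (x0 := x0) hp
      (by linarith) (by linarith) hr1 hpr (hu.neg.mono (hb4 x0 hx0r))
      (fun x hx => by
        have h1 := heq x (hb4 x0 hx0r hx)
        have h2 : lap (fun x => - u x) x = - lap u x := by
          exact lap_neg u x
        rw [h2, abs_neg]
        linarith)
      (by linarith)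
      (fun x hx => by
        have := hmin (ball_subset_closedBall (hb3 x0 hx0r hx))
        simp only [Set.mem_ofPred_eq] at this
        linarith)
      (by
        rw [circI_neg]
        have := hccirc x0 hx0r
        have : 0 ≤ 2 * π * (1 / p) := by positivity
        linarith)
    refine key.trans ?_
    gcongr
    · have := Real.log_nonneg hp.le
      positivity
    · exact Eventually.of_forall fun y => Real.rpow_nonneg (le_max_right _ _) _
    · have hi : IntegrableOn (fun y => (max (-u y) 0) ^ p) (ball c (3 * r)) :=
        (((cont_neg hp).comp_continuousOn hcu.neg).integrableOn_compact
          (isCompact_closedBall c (3 * r))).mono_set ball_subset_closedBall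
      exact hi
    · exact hb3 x0 hx0r
  · left
    intro y hy
    push Not at hneg
    have h1 := circI_quad (f := fun x => - u x) (c := y) (R := 3 * r) (a := 2 * r) (K := 0) (by linarith)
      (hu.neg.mono (hb4 y hy)) (by linarith) (by linarith)
      (fun z hz => by
        have hz3 := hb3 y hy hz
        have hz4 : z ∈ ball c (4 * r) := ball_subset_ball (by linarith) hz3
        rw [lap_neg, neg_neg] ; have hz5 := heq z hz4
        have h0 := hmin (ball_subset_closedBall hz3)
        simp only [Set.mem_ofPred_eq] at h0
        have h0' : 0 ≤ u z := by linarith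
        have : 0 ≤ |u z| ^ (p - 1) * u z := by positivity
        linarith)
    rw [circI_neg] at h1
    have h2 := hccirc y hy
    have h3 : 2 * π * (1 / p) ≤ 2 * π * u y := by linarith
    exact le_of_mul_le_mul_left h3 (by positivity)

lemma flux {u : E2 → ℝ} {p r α β : ℝ} {c : E2} (hp : 1 < p) (hr : 0 < r)
    (hu : ContDiffOn ℝ 2 u (ball c (4 * r)))
    (heq : ∀ x ∈ ball c (4 * r), - lap u x = |u x| ^ (p - 1) * u x)
    (hann : ∀ x, r ≤ dist x c → dist x c ≤ 3 * r → 1 / p ≤ u x)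
    (hα : ∀ x, dist x c = r → α ≤ u x) (hβ : ∀ x, dist x c = 3 * r → u x ≤ β) :
    2 * π * (α - β) ≤ (∫ y in ball c (3 * r), |u y| ^ (p - 1) * u y) * Real.log 3 := by
  have hcu : ContinuousOn u (closedBall c (3 * r)) :=
    hu.continuousOn.mono (closedBall_subset_ball (by linarith))
  have hiL : IntegrableOn (fun y => |u y| ^ (p - 1) * u y) (ball c (3 * r)) :=
    (((cont_nl hp).comp_continuousOn hcu).integrableOn_compact
      (isCompact_closedBall c (3 * r))).mono_set ball_subset_closedBall
  have hd : ∀ s : ℝ, 0 < s → ∀ θ, dist (c + s • circDir θ) c = s := by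
    intro s hs θ
    simp [dist_eq_norm, norm_smul, norm_circDir, abs_of_pos hs]
  have h1 := circI_ge u c r α (hcu.mono (closedBall_subset_closedBall (by rw [abs_of_pos hr]; linarith)))
    (fun θ => hα _ (hd r hr θ))
  have h2 := circI_le u c (3 * r) β (by rw [abs_of_pos (by linarith)]; exact hcu)
    (fun θ => hβ _ (hd (3 * r) (by linarith) θ))
  have h3 := circI_log (f := u) (c := c) (R := 4 * r) (a := r) (b := 3 * r)
    (K := ∫ y in ball c (3 * r), |u y| ^ (p - 1) * u y) (by linarith) hu hr (by linarith) (by linarith)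
    (fun s hs => by
      have hsR : ball c s ⊆ ball c (3 * r) := ball_subset_ball hs.2.le
      have e1 : - ∫ y in ball c s, lap u y = ∫ y in ball c s, |u y| ^ (p - 1) * u y := by
        rw [← integral_neg]
        exact setIntegral_congr_fun measurableSet_ball
          (fun y hy => heq y (ball_subset_ball (by linarith [hs.2]) hy))
      have e2 := setIntegral_union (μ := volume) (f := fun y => |u y| ^ (p - 1) * u y)
        (s := ball c s) (t := ball c (3 * r) \ ball c s)
        Set.disjoint_sdiff_right (measurableSet_ball.diff measurableSet_ball)
        (hiL.mono_set hsR) (hiL.mono_set Set.sdiff_subset)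
      rw [Set.union_sdiff_cancel hsR] at e2
      have e3 : 0 ≤ ∫ y in ball c (3 * r) \ ball c s, |u y| ^ (p - 1) * u y := by
        apply setIntegral_nonneg (measurableSet_ball.diff measurableSet_ball)
        intro y hy
        have hy1 := hy.1
        have hy2 := hy.2
        rw [mem_ball] at hy1
        rw [mem_ball, not_lt] at hy2
        have := hann y (by linarith [hs.1]) hy1.le
        have hup : 0 ≤ u y := le_trans (by positivity) this
        positivity
      linarith)
  have e : 3 * r / r = 3 := by field_simp
  rw [e] at h3
  linarith

lemma split_int {u : E2 → ℝ} {p s : ℝ} {c : E2} (hp : 1 < p) (hcu : ContinuousOn u (closedBall c s)) :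
    ∫ y in ball c s, |u y| ^ p = (∫ y in ball c s, |u y| ^ (p - 1) * u y) +
      2 * ∫ y in ball c s, (max (-u y) 0) ^ p := by
  have hiL : IntegrableOn (fun y => |u y| ^ (p - 1) * u y) (ball c s) :=
    (((cont_nl hp).comp_continuousOn hcu).integrableOn_compact
      (isCompact_closedBall c s)).mono_set ball_subset_closedBall
  have hi : IntegrableOn (fun y => (max (-u y) 0) ^ p) (ball c s) :=
    (((cont_neg hp).comp_continuousOn hcu.neg).integrableOn_compact
      (isCompact_closedBall c s)).mono_set ball_subset_closedBall
  rw [← integral_const_mul, ← integral_add hiL (hi.const_mul 2)]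
  congr 1; ext y
  exact nl_split hp


lemma sqrt_e_lower : (1.648 : ℝ) ≤ Real.sqrt (Real.exp 1) := by
  apply Real.le_sqrt_of_sq_le
  have := Real.exp_one_gt_d9
  norm_num
  linarith

lemma local_asymp (h : E2 → ℝ) (c : E2) (hc : ContinuousAt h c) :
    ∃ r1 > 0, ∀ r, 0 < r → r < r1 → ∀ (p : ℝ) (u : E2 → ℝ), 1 < p →
      ContDiffOn ℝ 2 u (ball c (4 * r)) →
      (∀ x ∈ ball c (4 * r), - lap u x = |u x| ^ (p - 1) * u x) →
      (∀ x, r ≤ dist x c → dist x c ≤ 3 * r →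
        |p * u x - (-(4 * Real.sqrt (Real.exp 1)) * Real.log ‖c - x‖ + h x)| < 1 / 1000) →
      (∀ x, r ≤ dist x c → dist x c ≤ 3 * r → 1 / p ≤ u x) ∧
      13.12 * π ≤ p * ∫ y in ball c (3 * r), |u y| ^ (p - 1) * u y := by
  set L := 4 * Real.sqrt (Real.exp 1) with hL
  have hLl : 6.592 ≤ L := by have := sqrt_e_lower; linarith
  have hL0 : 0 < L := by linarith
  obtain ⟨δ, hδ, hball⟩ := Metric.continuousAt_iff.1 hc (1 / 1000) (by norm_num)
  refine ⟨min (δ / 3) (Real.exp ((h c - 3) / L) / 3), by positivity, ?_⟩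
  intro r hr hr1 p u hp hu heq hclose
  have hp0 : 0 < p := by linarith
  have hpi := Real.pi_pos
  have hrδ : 3 * r < δ := by linarith [hr1.trans_le (min_le_left _ _)]
  have hre : 3 * r < Real.exp ((h c - 3) / L) := by linarith [hr1.trans_le (min_le_right _ _)]
  have hlog : L * Real.log (3 * r) ≤ h c - 3 := by
    have h1 := Real.log_le_log (by linarith) hre.le
    rw [Real.log_exp, le_div_iff₀ hL0] at h1
    linarith
  have hb : ∀ x, r ≤ dist x c → dist x c ≤ 3 * r →
      |p * u x - (- L * Real.log (dist x c) + h c)| ≤ 2 / 1000 := by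
    intro x h1 h2
    have e1 := hclose x h1 h2
    have e2 := hball (lt_of_le_of_lt h2 hrδ)
    rw [Real.dist_eq] at e2
    rw [← dist_eq_norm, dist_comm] at e1
    rw [abs_lt] at e1 e2
    rw [abs_le]
    constructor <;> linarith [e1.1, e1.2, e2.1, e2.2]
  have hann : ∀ x, r ≤ dist x c → dist x c ≤ 3 * r → 1 / p ≤ u x := by
    intro x h1 h2
    have e1 := (abs_le.1 (hb x h1 h2)).1
    have e2 : Real.log (dist x c) ≤ Real.log (3 * r) := Real.log_le_log (by linarith) h2
    have e3 := mul_le_mul_of_nonneg_left e2 hL0.le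
    rw [div_le_iff₀ hp0]
    linarith
  refine ⟨hann, ?_⟩
  have key := flux (α := (-L * Real.log r + h c - 2 / 1000) / p)
    (β := (-L * Real.log (3 * r) + h c + 2 / 1000) / p) hp hr hu heq hann
    (fun x hx => by
      have e1 := (abs_le.1 (hb x hx.ge (by linarith))).1
      rw [hx] at e1
      rw [div_le_iff₀ hp0]
      linarith)
    (fun x hx => by
      have e1 := (abs_le.1 (hb x (by linarith) hx.le)).2
      rw [hx] at e1
      rw [le_div_iff₀ hp0]
      linarith)
  set S := ∫ y in ball c (3 * r), |u y| ^ (p - 1) * u y with hS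
  have hl3 : 1 ≤ Real.log 3 := by
    rw [Real.le_log_iff_exp_le (by norm_num)]
    linarith [Real.exp_one_lt_d9]
  have e1 : (-L * Real.log r + h c - 2 / 1000) / p - (-L * Real.log (3 * r) + h c + 2 / 1000) / p
      = (L * Real.log 3 - 4 / 1000) / p := by
    rw [Real.log_mul (by norm_num) hr.ne']
    field_simp
    ring
  rw [e1] at key
  have k2 : 2 * π * (L * Real.log 3 - 4 / 1000) ≤ p * S * Real.log 3 := by
    have := mul_le_mul_of_nonneg_left key hp0.le
    have e2 : p * (2 * π * ((L * Real.log 3 - 4 / 1000) / p)) = 2 * π * (L * Real.log 3 - 4 / 1000) := by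
      field_simp
    linarith
  have k3 : 13.12 * π * Real.log 3 ≤ p * S * Real.log 3 := by
    refine le_trans ?_ k2
    have : 13.12 * Real.log 3 ≤ 2 * (L * Real.log 3 - 4 / 1000) := by nlinarith
    nlinarith
  exact le_of_mul_le_mul_right k3 (by linarith)

lemma green_decomp {Ω : Set E2} (hΩo : IsOpen Ω) (gd : GreenData Ω) {c c' : E2} (hc : c ∈ Ω)
    (hc' : c' ∈ Ω) (hne : c ≠ c') : ∃ h : E2 → ℝ, ContinuousAt h c ∧
      ∀ x, 8 * π * Real.sqrt (Real.exp 1) * (gd.G c x - gd.G c' x) =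
        -(4 * Real.sqrt (Real.exp 1)) * Real.log ‖c - x‖ + h x := by
  have hnb : closure Ω ∈ 𝓝 c := mem_of_superset (hΩo.mem_nhds hc) subset_closure
  refine ⟨fun x => 8 * π * Real.sqrt (Real.exp 1) *
    (gd.H c x - (-(1 / (2 * π)) * Real.log ‖c' - x‖ + gd.H c' x)), ?_, ?_⟩
  · have h1 := (gd.contH c hc).continuousAt hnb
    have h2 := (gd.contH c' hc').continuousAt hnb
    have h3 : ContinuousAt (fun x => Real.log ‖c' - x‖) c := by
      apply ContinuousAt.log (by fun_prop)
      rw [norm_ne_zero_iff, sub_ne_zero]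
      exact hne.symm
    exact continuousAt_const.mul (h1.sub ((continuousAt_const.mul h3).add h2))
  · intro x
    rw [gd.decomp c x, gd.decomp c' x]
    have := Real.pi_pos.ne'
    field_simp
    ring

lemma unif_extract {S : Set E2} {F : ℕ → E2 → ℝ} {g : E2 → ℝ} (h : TendstoC2LocOn S F g)
    {K : Set E2} (hK : K ⊆ S) (hKc : IsCompact K) {ε : ℝ} (hε : 0 < ε) :
    ∀ᶠ n in atTop, ∀ x ∈ K, |F n x - g x| < ε := by
  have h0 := Metric.tendstoUniformlyOn_iff.1 (h K hK hKc 0 (by norm_num)) ε hε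
  filter_upwards [h0] with n hn x hx
  have := hn x hx
  rw [iteratedFDeriv_zero_eq_comp, iteratedFDeriv_zero_eq_comp] at this
  simp only [Function.comp, LinearIsometryEquiv.dist_map] at this
  rw [Real.dist_eq, abs_sub_comm] at this
  exact this

lemma young {t p : ℝ} (ht : 0 ≤ t) (hp : 1 < p) :
    t ^ p ≤ (20 / 19) * t ^ (p + 1) + (19 / 20 : ℝ) ^ p := by
  rcases le_total t (19 / 20) with h | h
  · have := Real.rpow_le_rpow ht h (by linarith : 0 ≤ p)
    have : 0 ≤ t ^ (p + 1) := Real.rpow_nonneg ht _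
    linarith
  · have h0 : 0 < t := by linarith
    rw [Real.rpow_add_one h0.ne']
    have h1 : 0 ≤ t ^ p := Real.rpow_nonneg ht _
    have h2 : 0 ≤ (19 / 20 : ℝ) ^ p := Real.rpow_nonneg (by norm_num) _
    nlinarith

lemma annulus_compact (c : E2) (a b : ℝ) : IsCompact {x : E2 | a ≤ dist x c ∧ dist x c ≤ b} := by
  apply (isCompact_closedBall c b).of_isClosed_subset
  · have hd : Continuous (fun x : E2 => dist x c) := by fun_prop
    exact (isClosed_le continuous_const hd).inter (isClosed_le hd continuous_const)
  · intro x hx; exact hx.2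

lemma lim1 : ∀ᶠ p : ℝ in atTop, 1 / p + 10.8 * (Real.log p / p + 1 / Real.exp 1) < 4 := by
  have h1 : Tendsto (fun p : ℝ => 1 / p) atTop (𝓝 0) := by
    simpa using tendsto_inv_atTop_zero (𝕜 := ℝ)
  have h2 : Tendsto (fun p : ℝ => Real.log p / p) atTop (𝓝 0) := by
    have := Real.isLittleO_log_id_atTop.tendsto_div_nhds_zero
    simpa using this
  have h3 := h1.add ((h2.add_const (1 / Real.exp 1)).const_mul 10.8)
  refine h3.eventually (gt_mem_nhds ?_)
  have := Real.exp_one_gt_d9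
  have h4 : 1 / Real.exp 1 < 0.37 := by
    rw [div_lt_iff₀ (Real.exp_pos 1)]; linarith
  linarith

lemma lim2 (V : ℝ) : ∀ᶠ p : ℝ in atTop, p * (19 / 20 : ℝ) ^ p * V < 0.01 * π := by
  have h1 := tendsto_rpow_mul_exp_neg_mul_atTop_nhds_zero 1 (-Real.log (19 / 20))
    (by have := Real.log_neg (x := 19 / 20) (by norm_num) (by norm_num); linarith)
  have h2 := h1.mul_const V
  rw [zero_mul] at h2
  filter_upwards [h2.eventually (gt_mem_nhds (show 0 < 0.01 * π by have := Real.pi_pos; positivity))]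
    with p hp
  rw [Real.rpow_def_of_pos (by norm_num)]
  simpa using hp

/-- the alternative of `near_point` combined with `local_asymp` -/
lemma local_final {u : E2 → ℝ} {p r : ℝ} {c : E2} (hp : 1 < p) (hr : 0 < r) (hr1 : 2 * r ≤ 1)
    (hpr : 1 ≤ p * (2 * r) ^ 2)
    (hlim : 1 / p + 10.8 * (Real.log p / p + 1 / Real.exp 1) < 4)
    (hu : ContDiffOn ℝ 2 u (ball c (4 * r)))
    (heq : ∀ x ∈ ball c (4 * r), - lap u x = |u x| ^ (p - 1) * u x)
    (hann : ∀ x, r ≤ dist x c → dist x c ≤ 3 * r → 1 / p ≤ u x)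
    (hS : 13.12 * π ≤ p * ∫ y in ball c (3 * r), |u y| ^ (p - 1) * u y) :
    13.12 * π ≤ p * ∫ y in ball c (3 * r), |u y| ^ p ∧
    ((∀ y ∈ ball c r, 1 / p ≤ u y) ∨ 34.72 * π ≤ p * ∫ y in ball c (3 * r), |u y| ^ p) := by
  have hp0 : 0 < p := by linarith
  have hpi := Real.pi_pos
  rw [split_int hp (hu.continuousOn.mono (closedBall_subset_ball (by linarith)))]
  have hN0 : 0 ≤ ∫ y in ball c (3 * r), (max (-u y) 0) ^ p := setIntegral_nonneg measurableSet_ball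
    (fun y _ => Real.rpow_nonneg (le_max_right _ _) _)
  have hnp := near_point hp hr hr1 hpr hu heq hann
  set N := ∫ y in ball c (3 * r), (max (-u y) 0) ^ p
  set S := ∫ y in ball c (3 * r), |u y| ^ (p - 1) * u y
  have hpN : 0 ≤ p * N := by positivity
  refine ⟨by linarith, hnp.imp id fun h => ?_⟩
  suffices 10.8 * π ≤ p * N by linarith
  by_contra hcon
  push Not at hcon
  set D := Real.log p / p + 1 / Real.exp 1 with hD
  have hD0 : 0 < D := by
    have := Real.log_nonneg hp.le
    positivity
  have e : N * (Real.log p + p / Real.exp 1) = p * N * D := by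
    rw [hD]; field_simp
  rw [e] at h
  have h2 : p * N * D ≤ 10.8 * π * D := mul_le_mul_of_nonneg_right hcon.le hD0.le
  have h3 : π * (1 / p + 10.8 * D) < π * 4 := mul_lt_mul_of_pos_left hlim hpi
  have h4 : π / p = π * (1 / p) := by ring
  linarith

/-- Lemma 3.1: definite sign of `u_p` near the concentration points:
there are `p₀` and `ϱ₀ ∈ (0, r₀/2)` such that (up to a subsequence) for `p > p₀`,
`u_p ≥ 1/p` on `B_{2ϱ₀}(x₁)` and `u_p ≤ −1/p` on `B_{2ϱ₀}(x₂)`. -/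
theorem sign_near_concentration_points
    (Ω : Set E2) (hΩo : IsOpen Ω) (hΩb : IsBounded Ω) (hΩne : Ω.Nonempty)
    (p : ℕ → ℝ) (hp1 : ∀ n, 1 < p n) (hptop : Tendsto p atTop atTop)
    (u : ℕ → E2 → ℝ)
    (hsol : ∀ n, IsSolution Ω (p n) (u n))
    (hnod : ∀ n, IsNodal Ω (u n))
    (hlow : Tendsto (fun n => p n * ∫ x in Ω, |u n x| ^ (p n + 1)) atTop
      (𝓝 (16 * π * Real.exp 1)))
    (gd : GreenData Ω) (xP xM : E2) (hxP : xP ∈ Ω) (hxM : xM ∈ Ω) (hPM : xP ≠ xM)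
    (hconc : TendstoC2LocOn (closure Ω \ {xP, xM})
      (fun n x => p n * u n x)
      (fun x => 8 * π * Real.sqrt (Real.exp 1) * (gd.G xP x - gd.G xM x)))
    (r0 : ℝ) (hr0 : 0 < r0)
    (hdisj : Disjoint (ball xP (2 * r0)) (ball xM (2 * r0))) :
    ∃ φ : ℕ → ℕ, StrictMono φ ∧
      ∃ ϱ0 ∈ Set.Ioo (0:ℝ) (r0 / 2), ∃ N : ℕ, ∀ n ≥ N,
        (∀ y ∈ ball xP (2 * ϱ0), 1 / p (φ n) ≤ u (φ n) y) ∧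
        (∀ y ∈ ball xM (2 * ϱ0), u (φ n) y ≤ -(1 / p (φ n))) := by
  have hpi := Real.pi_pos
  obtain ⟨hP, hPc, hPeq⟩ := green_decomp hΩo gd hxP hxM hPM
  obtain ⟨hM, hMc, hMeq⟩ := green_decomp hΩo gd hxM hxP hPM.symm
  obtain ⟨rP, hrP, HP⟩ := local_asymp hP xP hPc
  obtain ⟨rM, hrM, HM⟩ := local_asymp hM xM hMc
  obtain ⟨εP, hεP, hbP⟩ := Metric.isOpen_iff.1 hΩo xP hxP
  obtain ⟨εM, hεM, hbM⟩ := Metric.isOpen_iff.1 hΩo xM hxM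
  have hdist : 0 < dist xP xM := dist_pos.2 hPM
  obtain ⟨r, hr, hr1, hr2, hr3, hr4, hr5, hr6⟩ : ∃ r : ℝ, 0 < r ∧ r < rP ∧ r < rM ∧ 4 * r ≤ εP ∧
      4 * r ≤ εM ∧ 2 * r ≤ 1 ∧ 6 * r < dist xP xM := by
    have hm : 0 < min (min rP rM) (min (min εP εM) (min 1 (dist xP xM))) := by positivity
    set m := min (min rP rM) (min (min εP εM) (min 1 (dist xP xM))) with hmdef
    have a1 : m ≤ rP := (min_le_left _ _).trans (min_le_left _ _)
    have a2 : m ≤ rM := (min_le_left _ _).trans (min_le_right _ _)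
    have a3 : m ≤ εP := (min_le_right _ _).trans ((min_le_left _ _).trans (min_le_left _ _))
    have a4 : m ≤ εM := (min_le_right _ _).trans ((min_le_left _ _).trans (min_le_right _ _))
    have a5 : m ≤ 1 := (min_le_right _ _).trans ((min_le_right _ _).trans (min_le_left _ _))
    have a6 : m ≤ dist xP xM := (min_le_right _ _).trans ((min_le_right _ _).trans (min_le_right _ _))
    exact ⟨m / 8, by linarith, by linarith, by linarith, by linarith, by linarith, by linarith, by linarith⟩
  have hsP : ball xP (4 * r) ⊆ Ω := (ball_subset_ball hr3).trans hbP
  have hsM : ball xM (4 * r) ⊆ Ω := (ball_subset_ball hr4).trans hbM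
  have hKP : {x : E2 | r ≤ dist x xP ∧ dist x xP ≤ 3 * r} ⊆ closure Ω \ {xP, xM} := by
    intro x hx
    refine ⟨subset_closure (hsP (by rw [mem_ball]; linarith [hx.2])), ?_⟩
    rintro (rfl | hxx)
    · have := hx.1
      rw [dist_self] at this
      linarith
    · rw [Set.mem_singleton_iff] at hxx
      have := hx.2
      rw [hxx, dist_comm] at this
      linarith
  have hKM : {x : E2 | r ≤ dist x xM ∧ dist x xM ≤ 3 * r} ⊆ closure Ω \ {xP, xM} := by
    intro x hx
    refine ⟨subset_closure (hsM (by rw [mem_ball]; linarith [hx.2])), ?_⟩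
    rintro (rfl | hxx)
    · have := hx.2
      linarith
    · rw [Set.mem_singleton_iff] at hxx
      have := hx.1
      rw [hxx, dist_self] at this
      linarith
  have cP := unif_extract hconc hKP (annulus_compact _ _ _) (show (0:ℝ) < 1 / 1000 by norm_num)
  have cM := unif_extract hconc hKM (annulus_compact _ _ _) (show (0:ℝ) < 1 / 1000 by norm_num)
  have hen : ∀ᶠ n in atTop, p n * ∫ x in Ω, |u n x| ^ (p n + 1) < 16 * π * Real.exp 1 + 0.01 * π :=
    hlow.eventually (gt_mem_nhds (by linarith))
  have hl1 := hptop.eventually lim1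
  have hl2 := hptop.eventually (lim2 (volume.real Ω))
  have hl3 := hptop.eventually (eventually_ge_atTop (1 / (2 * r) ^ 2))
  have hcompact : IsCompact (closure Ω) := hΩb.isCompact_closure
  have hvol : volume Ω < ⊤ := hΩb.measure_lt_top
  obtain ⟨N, hN⟩ := eventually_atTop.1 (cP.and (cM.and (hen.and (hl1.and (hl2.and hl3)))))
  refine ⟨id, strictMono_id, min (r / 2) (r0 / 4), ⟨by positivity, ?_⟩, N, ?_⟩
  · exact (min_le_right _ _).trans_lt (by linarith)
  intro n hn
  obtain ⟨cPn, cMn, henn, hl1n, hl2n, hl3n⟩ := hN n hn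
  simp only [id]
  obtain ⟨hC2, hcont, hpde, -⟩ := hsol n
  have hp := hp1 n
  have hp0 : 0 < p n := by linarith
  have hpr : 1 ≤ p n * (2 * r) ^ 2 := by
    rwa [div_le_iff₀ (by positivity)] at hl3n
  -- data at `xP`
  have uP := hC2.mono hsP
  have eP : ∀ x ∈ ball xP (4 * r), -lap (u n) x = |u n x| ^ (p n - 1) * u n x := fun x hx =>
    hpde x (hsP hx)
  obtain ⟨annP, SP⟩ := HP r hr hr1 (p n) (u n) hp uP eP (fun x h1 h2 => by
    rw [← hPeq]; exact cPn x ⟨h1, h2⟩)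
  obtain ⟨lowP, altP⟩ := local_final hp hr hr5 hpr hl1n uP eP annP SP
  -- data at `xM`
  have uM : ContDiffOn ℝ 2 (fun x => - u n x) (ball xM (4 * r)) := (hC2.mono hsM).neg
  have eM : ∀ x ∈ ball xM (4 * r), -lap (fun x => - u n x) x = |-u n x| ^ (p n - 1) * -u n x := by
    intro x hx
    rw [lap_neg, abs_neg]
    linarith [hpde x (hsM hx)]
  obtain ⟨annM, SM⟩ := HM r hr hr2 (p n) (fun x => - u n x) hp uM eM (fun x h1 h2 => by
    rw [← hMeq]
    have := cMn x ⟨h1, h2⟩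
    rw [← abs_neg] at this
    convert this using 2
    ring)
  obtain ⟨lowM, altM⟩ := local_final hp hr hr5 hpr hl1n uM eM annM SM
  simp only [abs_neg] at lowM altM
  -- total mass
  have iP : IntegrableOn (fun y => |u n y| ^ p n) Ω :=
    ((hcont.abs.rpow_const (fun _ _ => Or.inr hp0.le)).integrableOn_compact hcompact).mono_set subset_closure
  have iP1 : IntegrableOn (fun y => |u n y| ^ (p n + 1)) Ω :=
    ((hcont.abs.rpow_const (fun _ _ => Or.inr (by linarith))).integrableOn_compact hcompact).mono_set
      subset_closure
  have s3P : ball xP (3 * r) ⊆ Ω := (ball_subset_ball (by linarith)).trans hsP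
  have s3M : ball xM (3 * r) ⊆ Ω := (ball_subset_ball (by linarith)).trans hsM
  have hlower : (∫ y in ball xP (3 * r), |u n y| ^ p n) + (∫ y in ball xM (3 * r), |u n y| ^ p n) ≤
      ∫ y in Ω, |u n y| ^ p n := by
    rw [← setIntegral_union (ball_disjoint_ball (by linarith)) measurableSet_ball
      (iP.mono_set s3P) (iP.mono_set s3M)]
    exact setIntegral_mono_set iP (Eventually.of_forall fun y => Real.rpow_nonneg (abs_nonneg _) _)
      (Set.union_subset s3P s3M).eventuallyLE
  have hupper : ∫ y in Ω, |u n y| ^ p n ≤ (20 / 19) * (∫ y in Ω, |u n y| ^ (p n + 1)) +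
      (19 / 20 : ℝ) ^ p n * volume.real Ω := by
    have hconst : IntegrableOn (fun _ : E2 => (19 / 20 : ℝ) ^ p n) Ω := integrableOn_const hvol.ne
    calc ∫ y in Ω, |u n y| ^ p n ≤
        ∫ y in Ω, ((20 / 19) * |u n y| ^ (p n + 1) + (19 / 20 : ℝ) ^ p n) :=
          setIntegral_mono_on iP ((iP1.const_mul _).add hconst) hΩo.measurableSet
            (fun y _ => young (abs_nonneg _) hp)
      _ = _ := by
          rw [integral_add (iP1.const_mul _) hconst, integral_const_mul, setIntegral_const, smul_eq_mul]
          ring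
  have htot : p n * (∫ y in ball xP (3 * r), |u n y| ^ p n) +
      p n * (∫ y in ball xM (3 * r), |u n y| ^ p n) < 47 * π := by
    have h1 := mul_le_mul_of_nonneg_left (hlower.trans hupper) hp0.le
    have h2 : π * Real.exp 1 ≤ π * 2.7183 :=
      mul_le_mul_of_nonneg_left (by linarith [Real.exp_one_lt_d9]) hpi.le
    nlinarith
  refine ⟨fun y hy => ?_, fun y hy => ?_⟩
  · rcases altP with h | h
    · exact h y (ball_subset_ball (by linarith [min_le_left (r / 2) (r0 / 4)]) hy)
    · linarith
  · rcases altM with h | h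
    · have := h y (ball_subset_ball (by linarith [min_le_left (r / 2) (r0 / 4)]) hy)
      linarith
    · linarith

end
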